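/- Let m be even, q a primitive m-th root of unity, and suppose n + r is even. If n and r are both odd, then (Z_{n,1}···Z_{2,1}Z_{1,1}Z_{1,2}···Z_{1,r})^{m/2} is central in the quasipolynomial algebra M̄_q(n,r); if n and r are both even, then (Z_{n,1}···Z_{2,1}Z_{1,2}···Z_{1,r})^{m/2} is central in M̄_q(n,r). -/

import Mathlib

open scoped BigOperators

/-- Defining relations of the quasipolynomial algebra `M̄_q(n,r)` associated with the
quantized matrix algebra `M_q(n,r)`. -/
inductive QBarRel (k : Type) [Field k] (q : k) (n r : ℕ) :
    FreeAlgebra k (Fin n × Fin r) → FreeAlgebra k (Fin n × Fin r) → Prop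
  | row (i : Fin n) (j l : Fin r) (h : j < l) :
      QBarRel k q n r (FreeAlgebra.ι k (i, j) * FreeAlgebra.ι k (i, l))
        (q • (FreeAlgebra.ι k (i, l) * FreeAlgebra.ι k (i, j)))
  | col (i s : Fin n) (j : Fin r) (h : i < s) :
      QBarRel k q n r (FreeAlgebra.ι k (i, j) * FreeAlgebra.ι k (s, j))
        (q • (FreeAlgebra.ι k (s, j) * FreeAlgebra.ι k (i, j)))
  | cross (i s : Fin n) (j l : Fin r) (h1 : i ≠ s) (h2 : j ≠ l) :
      QBarRel k q n r (FreeAlgebra.ι k (i, j) * FreeAlgebra.ι k (s, l))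
        (FreeAlgebra.ι k (s, l) * FreeAlgebra.ι k (i, j))

/-- The quasipolynomial algebra `M̄_q(n,r)`. -/
abbrev QBar (k : Type) [Field k] (q : k) (n r : ℕ) : Type := RingQuot (QBarRel k q n r)

/-- The generator `Z_{i,j}` of `M̄_q(n,r)`. -/
noncomputable def ZbarGen (k : Type) [Field k] (q : k) (n r : ℕ) (i : Fin n) (j : Fin r) :
    QBar k q n r :=
  RingQuot.mkAlgHom k (QBarRel k q n r) (FreeAlgebra.ι k (i, j))

/-- The ordered product `Z_{n,1} ⋯ Z_{2,1} Z_{1,1} Z_{1,2} ⋯ Z_{1,r}` in `M̄_q(n,r)`. -/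
noncomputable def hookProdOdd (k : Type) [Field k] (q : k) (n r : ℕ)
    (hn : 0 < n) (hr : 0 < r) : QBar k q n r :=
  (List.ofFn fun t : Fin (n + r - 1) =>
      if (t : ℕ) + 1 ≤ n then
        ZbarGen k q n r ⟨(n - 1 - (t : ℕ)) % n, Nat.mod_lt _ hn⟩ ⟨0 % r, Nat.mod_lt _ hr⟩
      else
        ZbarGen k q n r ⟨0 % n, Nat.mod_lt _ hn⟩
          ⟨((t : ℕ) + 1 - n) % r, Nat.mod_lt _ hr⟩).prod

/-- The ordered product `Z_{n,1} ⋯ Z_{2,1} Z_{1,2} ⋯ Z_{1,r}` in `M̄_q(n,r)`. -/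
noncomputable def hookProdEven (k : Type) [Field k] (q : k) (n r : ℕ)
    (hn : 0 < n) (hr : 0 < r) : QBar k q n r :=
  (List.ofFn fun t : Fin (n + r - 2) =>
      if (t : ℕ) + 2 ≤ n then
        ZbarGen k q n r ⟨(n - 1 - (t : ℕ)) % n, Nat.mod_lt _ hn⟩ ⟨0 % r, Nat.mod_lt _ hr⟩
      else
        ZbarGen k q n r ⟨0 % n, Nat.mod_lt _ hn⟩
          ⟨((t : ℕ) + 2 - n) % r, Nat.mod_lt _ hr⟩).prod

/-- `x` and `y` commute up to a scalar whose `h`-th power is `s ^ e`. -/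
def CommutesUpTo {K A : Type*} [Field K] [Ring A] [Algebra K A] (h : ℕ) (s : K)
    (x y : A) (e : ℕ) : Prop :=
  ∃ c : K, c ^ h = s ^ e ∧ x * y = c • (y * x)

namespace CommutesUpTo

variable {K A : Type*} [Field K] [Ring A] [Algebra K A] {h : ℕ} {s : K} {x y z : A} {d e : ℕ}

theorem one_right : CommutesUpTo h s x 1 0 := ⟨1, by simp, by simp⟩

theorem mul_right (hy : CommutesUpTo h s x y d) (hz : CommutesUpTo h s x z e) :
    CommutesUpTo h s x (y * z) (d + e) := by
  obtain ⟨c, hc, hxy⟩ := hy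
  obtain ⟨c', hc', hxz⟩ := hz
  refine ⟨c * c', by rw [mul_pow, hc, hc', pow_add], ?_⟩
  rw [← mul_assoc, hxy, smul_mul_assoc, mul_assoc, hxz, mul_smul_comm, smul_smul, mul_assoc]

theorem prod_ofFn {N : ℕ} {f : Fin N → A} {e : Fin N → ℕ}
    (hf : ∀ t, CommutesUpTo h s x (f t) (e t)) :
    CommutesUpTo h s x (List.ofFn f).prod (∑ t, e t) := by
  induction N with
  | zero => simpa using one_right
  | succ N ih =>
    rw [List.ofFn_succ, List.prod_cons, Fin.sum_univ_succ]
    exact (hf 0).mul_right (ih fun t => hf t.succ)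

theorem commute_pow (hxy : CommutesUpTo h s x y e) (hs : s ^ 2 = 1) (he : Even e) :
    Commute x (y ^ h) := by
  obtain ⟨c, hc, hxy⟩ := hxy
  have key : ∀ l : ℕ, x * y ^ l = c ^ l • (y ^ l * x) := by
    intro l
    induction l with
    | zero => simp
    | succ l ih =>
      rw [pow_succ y, ← mul_assoc, ih, smul_mul_assoc, mul_assoc, hxy, mul_smul_comm, smul_smul,
        pow_succ, mul_assoc]
  obtain ⟨d, rfl⟩ := he
  have hch : c ^ h = 1 := by rw [hc, ← two_mul, pow_mul, hs, one_pow]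
  rw [Commute, SemiconjBy, key, hch, one_smul]

end CommutesUpTo

section QBar

variable {K : Type} [Field K] {q : K} {n r : ℕ}

theorem ZbarGen_row (i : Fin n) {j l : Fin r} (h : j < l) :
    ZbarGen K q n r i j * ZbarGen K q n r i l =
      q • (ZbarGen K q n r i l * ZbarGen K q n r i j) := by
  simpa [ZbarGen] using RingQuot.mkAlgHom_rel K (QBarRel.row (k := K) (q := q) i j l h)

theorem ZbarGen_col {i s : Fin n} (j : Fin r) (h : i < s) :
    ZbarGen K q n r i j * ZbarGen K q n r s j =
      q • (ZbarGen K q n r s j * ZbarGen K q n r i j) := by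
  simpa [ZbarGen] using RingQuot.mkAlgHom_rel K (QBarRel.col (k := K) (q := q) i s j h)

theorem ZbarGen_cross {i s : Fin n} {j l : Fin r} (h₁ : i ≠ s) (h₂ : j ≠ l) :
    ZbarGen K q n r i j * ZbarGen K q n r s l = ZbarGen K q n r s l * ZbarGen K q n r i j := by
  simpa [ZbarGen] using RingQuot.mkAlgHom_rel K (QBarRel.cross (k := K) (q := q) i s j l h₁ h₂)

theorem mem_center_QBar_of_commute {a : QBar K q n r}
    (ha : ∀ i j, Commute (ZbarGen K q n r i j) a) : a ∈ Subalgebra.center K (QBar K q n r) := by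
  rw [Subalgebra.mem_center_iff]
  intro b
  obtain ⟨b, rfl⟩ := RingQuot.mkAlgHom_surjective K (QBarRel K q n r) b
  change Commute _ _
  induction b using FreeAlgebra.induction with
  | grade0 c => rw [AlgHom.commutes]; exact Algebra.commutes c a
  | grade1 p => exact ha p.1 p.2
  | mul b c hb hc => rw [map_mul]; exact hb.mul_left hc
  | add b c hb hc => rw [map_add]; exact hb.add_left hc

theorem commutesUpTo_ZbarGen {h : ℕ} (hq : (q ^ h) ^ 2 = 1) (hq0 : q ≠ 0)
    (i a : Fin n) (j b : Fin r) :
    CommutesUpTo h (q ^ h) (ZbarGen K q n r i j) (ZbarGen K q n r a b)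
      ((if (a : ℕ) = i then 1 else 0) + if (b : ℕ) = j then 1 else 0) := by
  have hinv : q⁻¹ ^ h = q ^ h := by
    rw [inv_pow]
    exact inv_eq_of_mul_eq_one_left (by rw [← sq, hq])
  simp only [← Fin.ext_iff]
  rcases eq_or_ne a i with rfl | hai <;> rcases eq_or_ne b j with rfl | hbj
  · exact ⟨1, by simp [hq], by simp⟩
  · rcases hbj.lt_or_gt with hlt | hlt
    · exact ⟨q⁻¹, by simp [hbj, hinv], by rw [ZbarGen_row a hlt, inv_smul_smul₀ hq0]⟩
    · exact ⟨q, by simp [hbj], ZbarGen_row a hlt⟩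
  · rcases hai.lt_or_gt with hlt | hlt
    · exact ⟨q⁻¹, by simp [hai, hinv], by rw [ZbarGen_col b hlt, inv_smul_smul₀ hq0]⟩
    · exact ⟨q, by simp [hai], ZbarGen_col b hlt⟩
  · exact ⟨1, by simp [hai, hbj], by rw [one_smul, ZbarGen_cross hai.symm hbj.symm]⟩

end QBar

theorem even_sum_hookOdd {n r : ℕ} (hn : Odd n) (hr : Odd r) {i j : ℕ} (hi : i < n)
    (hj : j < r) :
    Even (∑ t : Fin (n + r - 1), if (t : ℕ) + 1 ≤ n then
        (if n - 1 - (t : ℕ) = i then 1 else 0) + (if 0 = j then 1 else 0)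
      else (if 0 = i then 1 else 0) + if (t : ℕ) + 1 - n = j then 1 else 0) := by
  rw [Fin.sum_univ_eq_sum_range (fun t : ℕ => if t + 1 ≤ n then
        (if n - 1 - t = i then 1 else 0) + (if 0 = j then 1 else 0)
      else (if 0 = i then 1 else 0) + if t + 1 - n = j then 1 else 0),
    Nat.add_sub_assoc (by omega), Finset.sum_range_add]
  have h₁ : ∀ t ∈ Finset.range n, (if t + 1 ≤ n then
        (if n - 1 - t = i then 1 else 0) + (if 0 = j then 1 else 0)
      else (if 0 = i then 1 else 0) + if t + 1 - n = j then 1 else 0) =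
      (if t = n - 1 - i then 1 else 0) + (if 0 = j then 1 else 0) := by
    intro t ht
    rw [Finset.mem_range] at ht
    grind
  have h₂ : ∀ t ∈ Finset.range (r - 1), (if n + t + 1 ≤ n then
        (if n - 1 - (n + t) = i then 1 else 0) + (if 0 = j then 1 else 0)
      else (if 0 = i then 1 else 0) + if n + t + 1 - n = j then 1 else 0) =
      (if 0 = i then 1 else 0) + if t = j - 1 then (if 0 < j then 1 else 0) else 0 := by
    intro t _
    grind
  rw [Finset.sum_congr rfl h₁, Finset.sum_congr rfl h₂]
  simp only [Finset.sum_add_distrib, Finset.sum_ite_eq', Finset.sum_const, Finset.card_range,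
    Finset.mem_range, smul_eq_mul]
  grind

theorem even_sum_hookEven {n r : ℕ} (hn : Even n) (hr : Even r) {i j : ℕ} (hi : i < n)
    (hj : j < r) :
    Even (∑ t : Fin (n + r - 2), if (t : ℕ) + 2 ≤ n then
        (if n - 1 - (t : ℕ) = i then 1 else 0) + (if 0 = j then 1 else 0)
      else (if 0 = i then 1 else 0) + if (t : ℕ) + 2 - n = j then 1 else 0) := by
  rw [Fin.sum_univ_eq_sum_range (fun t : ℕ => if t + 2 ≤ n then
        (if n - 1 - t = i then 1 else 0) + (if 0 = j then 1 else 0)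
      else (if 0 = i then 1 else 0) + if t + 2 - n = j then 1 else 0),
    show n + r - 2 = (n - 1) + (r - 1) by omega, Finset.sum_range_add]
  have h₁ : ∀ t ∈ Finset.range (n - 1), (if t + 2 ≤ n then
        (if n - 1 - t = i then 1 else 0) + (if 0 = j then 1 else 0)
      else (if 0 = i then 1 else 0) + if t + 2 - n = j then 1 else 0) =
      (if t = n - 1 - i then 1 else 0) + (if 0 = j then 1 else 0) := by
    intro t ht
    rw [Finset.mem_range] at ht
    grind
  have h₂ : ∀ t ∈ Finset.range (r - 1), (if n - 1 + t + 2 ≤ n then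
        (if n - 1 - (n - 1 + t) = i then 1 else 0) + (if 0 = j then 1 else 0)
      else (if 0 = i then 1 else 0) + if n - 1 + t + 2 - n = j then 1 else 0) =
      (if 0 = i then 1 else 0) + if t = j - 1 then (if 0 < j then 1 else 0) else 0 := by
    intro t _
    grind
  rw [Finset.sum_congr rfl h₁, Finset.sum_congr rfl h₂]
  simp only [Finset.sum_add_distrib, Finset.sum_ite_eq', Finset.sum_const, Finset.card_range,
    Finset.mem_range, smul_eq_mul]
  grind

/-- Let `m` be even, `q` a primitive `m`-th root of unity, and suppose
`n + r` is even.  If `n` and `r` are both odd then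
`(Z_{n,1} ⋯ Z_{2,1} Z_{1,1} Z_{1,2} ⋯ Z_{1,r})^{m/2}` is central in `M̄_q(n,r)`;
if `n` and `r` are both even then `(Z_{n,1} ⋯ Z_{2,1} Z_{1,2} ⋯ Z_{1,r})^{m/2}` is
central in `M̄_q(n,r)`. -/
theorem hookProd_pow_mem_center_QBar
    (K : Type) [Field K] (q : K) (m : ℕ) (hm0 : 0 < m) (hmeven : Even m)
    (hq : IsPrimitiveRoot q m) (n r : ℕ) (hn : 0 < n) (hr : 0 < r)
    (hnr : Even (n + r)) :
    (Odd n → Odd r →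
      hookProdOdd K q n r hn hr ^ (m / 2) ∈ Subalgebra.center K (QBar K q n r)) ∧
    (Even n → Even r →
      hookProdEven K q n r hn hr ^ (m / 2) ∈ Subalgebra.center K (QBar K q n r)) := by
  have hs : (q ^ (m / 2)) ^ 2 = 1 := by
    rw [← pow_mul, Nat.div_mul_cancel hmeven.two_dvd, hq.pow_eq_one]
  have hq0 : q ≠ 0 := hq.ne_zero hm0.ne'
  refine ⟨fun hno hro => mem_center_QBar_of_commute fun i j => ?_,
    fun hne hre => mem_center_QBar_of_commute fun i j => ?_⟩
  · refine (CommutesUpTo.prod_ofFn fun t => ?_).commute_pow hs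
      (even_sum_hookOdd hno hro i.isLt j.isLt)
    by_cases ht : (t : ℕ) + 1 ≤ n
    · have htn : n - 1 - (t : ℕ) < n := by omega
      simp only [if_pos ht, Nat.zero_mod, Nat.mod_eq_of_lt htn]
      exact commutesUpTo_ZbarGen hs hq0 i ⟨_, htn⟩ j ⟨0, hr⟩
    · have htr : (t : ℕ) + 1 - n < r := by omega
      simp only [if_neg ht, Nat.zero_mod, Nat.mod_eq_of_lt htr]
      exact commutesUpTo_ZbarGen hs hq0 i ⟨0, hn⟩ j ⟨_, htr⟩
  · refine (CommutesUpTo.prod_ofFn fun t => ?_).commute_pow hs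
      (even_sum_hookEven hne hre i.isLt j.isLt)
    by_cases ht : (t : ℕ) + 2 ≤ n
    · have htn : n - 1 - (t : ℕ) < n := by omega
      simp only [if_pos ht, Nat.zero_mod, Nat.mod_eq_of_lt htn]
      exact commutesUpTo_ZbarGen hs hq0 i ⟨_, htn⟩ j ⟨0, hr⟩
    · have htr : (t : ℕ) + 2 - n < r := by omega
      simp only [if_neg ht, Nat.zero_mod, Nat.mod_eq_of_lt htr]
      exact commutesUpTo_ZbarGen hs hq0 i ⟨0, hn⟩ j ⟨_, htr⟩
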